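/- arXiv:1101.2510 — 4 statements merged into one kernel-verified Lean document; each statement's English description precedes it below -/
import Mathlib

section
/- Under the path measure μ_n, the variance of the occupation time of the free state satisfies Var[K_n] = (a·b·(2−a−b)/(a+b)³)·n − (2·a·b·(1−a−b)/(a+b)⁴)·(1 − (1−a−b)ⁿ). -/
open Finset

/-- Transition probabilities of the two-state Markov chain on `{free, adsorbed}`,
with `true` = free and `false` = adsorbed: `p(free→free)=1−b`, `p(free→adsorbed)=b`,
`p(adsorbed→free)=a`, `p(adsorbed→adsorbed)=1−a`. -/
noncomputable def transP (a b : ℝ) : Bool → Bool → ℝ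
  | true, true => 1 - b
  | true, false => b
  | false, true => a
  | false, false => 1 - a

/-- Stationary initial distribution: `π(free)=a/(a+b)`, `π(adsorbed)=b/(a+b)`. -/
noncomputable def statDist (a b : ℝ) : Bool → ℝ
  | true => a / (a + b)
  | false => b / (a + b)

/-- The path measure `μ_n(ω) = π(ω₀) · ∏_{k=0}^{n−1} p(ω_k → ω_{k+1})` on paths
`ω : {0,…,n} → {free, adsorbed}`. -/
noncomputable def pathMeasure (a b : ℝ) (n : ℕ) (ω : Fin (n + 1) → Bool) : ℝ :=
  statDist a b (ω 0) * ∏ k : Fin n, transP a b (ω k.castSucc) (ω k.succ)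

/-- The occupation time `K_n(ω) = #{k ∈ {1,…,n} : ω_k = free}` of the free state. -/
def occTime (n : ℕ) (ω : Fin (n + 1) → Bool) : ℕ :=
  (Finset.univ.filter fun k : Fin (n + 1) => 1 ≤ (k : ℕ) ∧ ω k = true).card

/-- Expectation under `pathMeasure` of a function of the occupation time and the final state. -/
noncomputable def pathExp (a b : ℝ) (n : ℕ) (F : ℝ → Bool → ℝ) : ℝ :=
  ∑ ω : Fin (n + 1) → Bool, pathMeasure a b n ω * F (occTime n ω) (ω (Fin.last n))

/-- The indicator of the free state. -/
def freeInd (x : Bool) : ℝ := if x = true then 1 else 0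

lemma occTime_eq_sum (n : ℕ) (ω : Fin (n + 1) → Bool) :
    (occTime n ω : ℝ) = ∑ k : Fin n, freeInd (ω k.succ) := by
  rw [occTime, Finset.card_filter, Fin.sum_univ_succ]
  simp [freeInd, -Finset.sum_boole]

lemma occTime_snoc (n : ℕ) (ω : Fin (n + 1) → Bool) (x : Bool) :
    (occTime (n + 1) (Fin.snoc ω x : Fin (n + 2) → Bool) : ℝ) = occTime n ω + freeInd x := by
  simp only [occTime_eq_sum, Fin.sum_univ_castSucc, Fin.succ_castSucc, Fin.succ_last,
    Fin.snoc_castSucc, Fin.snoc_last]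

lemma pathMeasure_snoc (a b : ℝ) (n : ℕ) (ω : Fin (n + 1) → Bool) (x : Bool) :
    pathMeasure a b (n + 1) (Fin.snoc ω x : Fin (n + 2) → Bool)
      = pathMeasure a b n ω * transP a b (ω (Fin.last n)) x := by
  have h0 : (Fin.snoc ω x : Fin (n + 2) → Bool) 0 = ω 0 :=
    Fin.snoc_castSucc (α := fun _ => Bool) x ω 0
  simp only [pathMeasure, h0, Fin.prod_univ_castSucc, Fin.succ_castSucc, Fin.succ_last,
    Fin.snoc_castSucc, Fin.snoc_last, mul_assoc]

/-- The Markov property: conditioning on the path up to time `n`. -/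
lemma pathExp_succ (a b : ℝ) (n : ℕ) (F : ℝ → Bool → ℝ) :
    pathExp a b (n + 1) F
      = pathExp a b n fun k s => ∑ x, transP a b s x * F (k + freeInd x) x := by
  unfold pathExp
  rw [← (Fin.snocEquiv fun _ : Fin (n + 2) => Bool).sum_comp, Fintype.sum_prod_type_right]
  refine Finset.sum_congr rfl fun ω _ => ?_
  rw [Finset.mul_sum]
  refine Finset.sum_congr rfl fun x _ => ?_
  change pathMeasure a b (n + 1) (Fin.snoc ω x : Fin (n + 2) → Bool)
    * F (occTime (n + 1) (Fin.snoc ω x : Fin (n + 2) → Bool))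
      ((Fin.snoc ω x : Fin (n + 2) → Bool) (Fin.last (n + 1))) = _
  rw [pathMeasure_snoc, occTime_snoc, Fin.snoc_last, mul_assoc]

lemma pathExp_zero (a b : ℝ) (F : ℝ → Bool → ℝ) :
    pathExp a b 0 F = a / (a + b) * F 0 true + b / (a + b) * F 0 false := by
  unfold pathExp
  rw [← (Equiv.funUnique (Fin 1) Bool).symm.sum_comp]
  simp [pathMeasure, occTime_eq_sum, statDist]

lemma pathExp_add (a b : ℝ) (n : ℕ) (F G : ℝ → Bool → ℝ) :
    pathExp a b n (fun k s => F k s + G k s) = pathExp a b n F + pathExp a b n G := by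
  simp [pathExp, mul_add, Finset.sum_add_distrib]

lemma pathExp_const_mul (a b : ℝ) (n : ℕ) (c : ℝ) (F : ℝ → Bool → ℝ) :
    pathExp a b n (fun k s => c * F k s) = c * pathExp a b n F := by
  simp [pathExp, Finset.mul_sum, mul_left_comm]

lemma pathExp_one {a b : ℝ} (h : a + b ≠ 0) (n : ℕ) : pathExp a b n (fun _ _ => 1) = 1 := by
  induction n with
  | zero => rw [pathExp_zero]; field_simp
  | succ n ih =>
    have hF : (fun (_ : ℝ) s => ∑ x, transP a b s x * 1) = fun _ _ => 1 := by
      funext k s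
      cases s <;> simp [transP]
    rw [pathExp_succ, hF, ih]

/-- Stationarity. -/
lemma pathExp_freeInd {a b : ℝ} (h : a + b ≠ 0) (n : ℕ) :
    pathExp a b n (fun _ s => freeInd s) = a / (a + b) := by
  induction n with
  | zero => rw [pathExp_zero]; simp [freeInd]
  | succ n ih =>
    have hF : (fun (_ : ℝ) s => ∑ x, transP a b s x * freeInd x)
        = fun _ s => a * 1 + (1 - a - b) * freeInd s := by
      funext k s
      cases s <;> (simp [transP, freeInd]; try ring)
    rw [pathExp_succ, hF, pathExp_add, pathExp_const_mul, pathExp_const_mul, pathExp_one h, ih]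
    field_simp
    ring

lemma pathExp_occTime {a b : ℝ} (h : a + b ≠ 0) (n : ℕ) :
    pathExp a b n (fun k _ => k) = n * (a / (a + b)) := by
  induction n with
  | zero => rw [pathExp_zero]; simp
  | succ n ih =>
    have hF : (fun (k : ℝ) s => ∑ x, transP a b s x * (k + freeInd x))
        = fun k s => k + (a * 1 + (1 - a - b) * freeInd s) := by
      funext k s
      cases s <;> simp [transP, freeInd] <;> ring
    rw [pathExp_succ, hF]
    simp only [pathExp_add, pathExp_const_mul, pathExp_one h, pathExp_freeInd h, ih]
    push_cast
    field_simp
    ring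

lemma pathExp_occTime_mul_freeInd {a b : ℝ} (h : a + b ≠ 0) (n : ℕ) :
    pathExp a b n (fun k s => k * freeInd s)
      = n * (a / (a + b)) ^ 2 + a * b / (a + b) ^ 3 * (1 - (1 - a - b) ^ n) := by
  induction n with
  | zero => rw [pathExp_zero]; simp
  | succ n ih =>
    have hF : (fun (k : ℝ) s => ∑ x, transP a b s x * ((k + freeInd x) * freeInd x))
        = fun k s => a * k + ((1 - a - b) * (k * freeInd s)
            + (a * 1 + (1 - a - b) * freeInd s)) := by
      funext k s
      cases s <;> simp [transP, freeInd] <;> ring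
    rw [pathExp_succ, hF]
    simp only [pathExp_add, pathExp_const_mul, pathExp_one h, pathExp_freeInd h,
      pathExp_occTime h, ih, pow_succ (1 - a - b) n]
    push_cast
    generalize (1 - a - b) ^ n = q
    field_simp
    ring

lemma pathExp_occTime_sq {a b : ℝ} (h : a + b ≠ 0) (n : ℕ) :
    pathExp a b n (fun k _ => k ^ 2)
      = (n * (a / (a + b))) ^ 2 + ((a * b * (2 - a - b) / (a + b) ^ 3) * n
        - (2 * a * b * (1 - a - b) / (a + b) ^ 4) * (1 - (1 - a - b) ^ n)) := by
  induction n with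
  | zero => rw [pathExp_zero]; simp
  | succ n ih =>
    have hF : (fun (k : ℝ) s => ∑ x, transP a b s x * (k + freeInd x) ^ 2)
        = fun k s => k ^ 2 + ((2 * a) * k + ((2 * (1 - a - b)) * (k * freeInd s)
            + (a * 1 + (1 - a - b) * freeInd s))) := by
      funext k s
      cases s <;> simp [transP, freeInd] <;> ring
    rw [pathExp_succ, hF]
    simp only [pathExp_add, pathExp_const_mul, pathExp_one h, pathExp_freeInd h,
      pathExp_occTime h, pathExp_occTime_mul_freeInd h, ih, pow_succ (1 - a - b) n]
    push_cast
    generalize (1 - a - b) ^ n = q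
    field_simp
    ring

/-- Under the path measure `μ_n`, the variance of the occupation time of the
free state satisfies
`Var[K_n] = (a·b·(2−a−b)/(a+b)³)·n − (2·a·b·(1−a−b)/(a+b)⁴)·(1 − (1−a−b)ⁿ)`. -/
theorem stmt3 (a b : ℝ) (ha : a ∈ Set.Ioo (0 : ℝ) 1) (hb : b ∈ Set.Ioo (0 : ℝ) 1)
    (n : ℕ) :
    ∑ ω : Fin (n + 1) → Bool, pathMeasure a b n ω *
        ((occTime n ω : ℝ)
          - ∑ ω' : Fin (n + 1) → Bool, pathMeasure a b n ω' * (occTime n ω' : ℝ)) ^ 2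
      = (a * b * (2 - a - b) / (a + b) ^ 3) * n
        - (2 * a * b * (1 - a - b) / (a + b) ^ 4) * (1 - (1 - a - b) ^ n) := by
  have h : a + b ≠ 0 := (add_pos ha.1 hb.1).ne'
  have hmean : ∑ ω' : Fin (n + 1) → Bool, pathMeasure a b n ω' * (occTime n ω' : ℝ)
      = n * (a / (a + b)) := pathExp_occTime h n
  rw [hmean]
  set m : ℝ := n * (a / (a + b)) with hm
  change pathExp a b n (fun k _ => (k - m) ^ 2) = _
  have hF : (fun (k : ℝ) (_ : Bool) => (k - m) ^ 2)
      = fun k _ => k ^ 2 + ((-2 * m) * k + m ^ 2 * 1) := by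
    funext k _
    ring
  rw [hF]
  simp only [pathExp_add, pathExp_const_mul, pathExp_one h, pathExp_occTime h,
    pathExp_occTime_sq h, ← hm]
  ring
end

section
/- Let λ, μ > 0, t > 0, D ≥ 0 and v ∈ ℝ. For n ∈ ℕ set Δt = t/n, a = μ·Δt, b = λ·Δt, r = 1 − (λ+μ)·Δt, and W_n = [a·b·(2−a−b)/(a+b)³ + 2·b·(a−b)·rⁿ/(a+b)³]·n + [b·(3a−b)/(a+b)³ − 4·a·b/(a+b)⁴]·(1 − rⁿ) + (b²/(a+b)⁴)·(1 − r²ⁿ). Then the sequence V_n = (a/(a+b))·2·D·t + W_n·v²·(Δt)² + (b·(1 − rⁿ)/(a+b)²)·2·D·Δt converges, as n → ∞, to (μ/(λ+μ))·2·D·t + (λ/(λ+μ)²)·(1 − exp(−(λ+μ)·t))·2·D + [2·λ·μ/(λ+μ)³ + (2·λ·(μ−λ)/(λ+μ)³)·exp(−(λ+μ)·t)]·v²·t − (4·λ·μ/(λ+μ)⁴)·(1 − exp(−(λ+μ)·t))·v² + (λ²/(λ+μ)⁴)·(1 − exp(−2·(λ+μ)·t))·v². -/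
/-- The variance with step `d = t / n` and geometric factor `E = r ^ n`, after cancelling the
powers of `d`: it is polynomial in `d` and `E`. -/
lemma variance_cancel_step {lam mu d : ℝ} (hs : lam + mu ≠ 0) (hd : d ≠ 0) (t D v E N : ℝ)
    (hN : N * d = t) :
    (mu * d / (mu * d + lam * d)) * 2 * D * t
      + ((mu * d * (lam * d) * (2 - mu * d - lam * d) / (mu * d + lam * d) ^ 3
            + 2 * (lam * d) * (mu * d - lam * d) * E / (mu * d + lam * d) ^ 3) * N
          + (lam * d * (3 * (mu * d) - lam * d) / (mu * d + lam * d) ^ 3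
            - 4 * (mu * d) * (lam * d) / (mu * d + lam * d) ^ 4) * (1 - E)
          + ((lam * d) ^ 2 / (mu * d + lam * d) ^ 4) * (1 - E ^ 2)) * v ^ 2 * d ^ 2
      + (lam * d * (1 - E) / (mu * d + lam * d) ^ 2) * 2 * D * d
    = (mu / (lam + mu)) * 2 * D * t
      + (lam / (lam + mu) ^ 2) * (1 - E) * 2 * D
      + (lam * mu * (2 - (lam + mu) * d) / (lam + mu) ^ 3
          + (2 * lam * (mu - lam) / (lam + mu) ^ 3) * E) * v ^ 2 * t
      + (lam * (3 * mu - lam) / (lam + mu) ^ 3 * d - 4 * lam * mu / (lam + mu) ^ 4)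
          * (1 - E) * v ^ 2
      + (lam ^ 2 / (lam + mu) ^ 4) * (1 - E ^ 2) * v ^ 2 := by
  subst hN
  have h : mu * d + lam * d = (lam + mu) * d := by ring
  rw [h]
  field_simp
  ring

/-- The discrete-time conditional variance `V_n` of the position at time
`t` of a particle that is free at time `t` (with `Δt = t/n`, `a = μ·Δt`, `b = λ·Δt`,
`r = 1 − (λ+μ)·Δt`, and `W_n` the conditional variance of the free occupation time)
converges as `n → ∞` to the stated continuous-time conditional variance. -/
theorem stmt11 (lam mu t D v : ℝ) (hlam : 0 < lam) (hmu : 0 < mu) (ht : 0 < t)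
    (hD : 0 ≤ D) :
    Filter.Tendsto (fun n : ℕ =>
        let Δt : ℝ := t / (n : ℝ)
        let a : ℝ := mu * Δt
        let b : ℝ := lam * Δt
        let r : ℝ := 1 - (lam + mu) * Δt
        let W : ℝ :=
          (a * b * (2 - a - b) / (a + b) ^ 3
              + 2 * b * (a - b) * r ^ n / (a + b) ^ 3) * n
            + (b * (3 * a - b) / (a + b) ^ 3 - 4 * a * b / (a + b) ^ 4) * (1 - r ^ n)
            + (b ^ 2 / (a + b) ^ 4) * (1 - r ^ (2 * n))
        (a / (a + b)) * 2 * D * t + W * v ^ 2 * Δt ^ 2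
          + (b * (1 - r ^ n) / (a + b) ^ 2) * 2 * D * Δt)
      Filter.atTop
      (nhds ((mu / (lam + mu)) * 2 * D * t
        + (lam / (lam + mu) ^ 2) * (1 - Real.exp (-(lam + mu) * t)) * 2 * D
        + (2 * lam * mu / (lam + mu) ^ 3
            + (2 * lam * (mu - lam) / (lam + mu) ^ 3) * Real.exp (-(lam + mu) * t))
          * v ^ 2 * t
        - (4 * lam * mu / (lam + mu) ^ 4) * (1 - Real.exp (-(lam + mu) * t)) * v ^ 2
        + (lam ^ 2 / (lam + mu) ^ 4) * (1 - Real.exp (-2 * (lam + mu) * t)) * v ^ 2)) := by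
  have hs : lam + mu ≠ 0 := (add_pos hlam hmu).ne'
  have hd : Filter.Tendsto (fun n : ℕ => t / (n : ℝ)) Filter.atTop (nhds 0) :=
    tendsto_const_div_atTop_nhds_zero_nat t
  have hE : Filter.Tendsto (fun n : ℕ => (1 - (lam + mu) * (t / (n : ℝ))) ^ n) Filter.atTop
      (nhds (Real.exp (-(lam + mu) * t))) := by
    refine (Real.tendsto_one_add_div_pow_exp (-(lam + mu) * t)).congr fun n => ?_
    congr 1
    ring
  have hexp : Real.exp (-2 * (lam + mu) * t) = Real.exp (-(lam + mu) * t) ^ 2 := by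
    rw [← Real.exp_nat_mul]
    congr 1
    push_cast
    ring
  have hcont : Continuous fun p : ℝ × ℝ =>
      (mu / (lam + mu)) * 2 * D * t
      + (lam / (lam + mu) ^ 2) * (1 - p.2) * 2 * D
      + (lam * mu * (2 - (lam + mu) * p.1) / (lam + mu) ^ 3
          + (2 * lam * (mu - lam) / (lam + mu) ^ 3) * p.2) * v ^ 2 * t
      + (lam * (3 * mu - lam) / (lam + mu) ^ 3 * p.1 - 4 * lam * mu / (lam + mu) ^ 4)
          * (1 - p.2) * v ^ 2
      + (lam ^ 2 / (lam + mu) ^ 4) * (1 - p.2 ^ 2) * v ^ 2 := by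
    fun_prop
  have hlim := (hcont.tendsto (0, Real.exp (-(lam + mu) * t))).comp (hd.prodMk_nhds hE)
  rw [hexp]
  convert hlim.congr' ?_ using 2
  · ring
  · filter_upwards [Filter.eventually_gt_atTop 0] with n hn
    have hn' : (n : ℝ) ≠ 0 := by exact_mod_cast hn.ne'
    have hstep := variance_cancel_step hs (div_ne_zero ht.ne' hn') t D v
      ((1 - (lam + mu) * (t / (n : ℝ))) ^ n) n (mul_div_cancel₀ t hn')
    simp only [Function.comp_apply, mul_comm 2 n, pow_mul]
    exact hstep.symm
end

section
/- Let λ, μ ≥ 0 with λ + μ > 0 and let v ∈ ℝ. Suppose u, w : ℝ × ℝ → ℝ are twice continuously differentiable functions of (x̄, t) satisfying, at every point, ∂u/∂t + ((λ−μ)/(λ+μ))·(v/2)·∂u/∂x̄ + (v/2)·∂w/∂x̄ = 0 and ∂w/∂t + ((λ−μ)/(λ+μ))·(v/2)·∂w/∂x̄ + (v/2)·∂u/∂x̄ = −(λ−μ)·u − (λ+μ)·w. Then u satisfies at every point the (asymmetric) telegrapher's equation (λ·μ·v²/(λ+μ)³)·∂²u/∂x̄² − (1/(λ+μ))·∂²u/∂t²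 − (v·(λ−μ)/(λ+μ)²)·∂²u/∂t∂x̄ = ∂u/∂t. -/
/-- Partial derivative with respect to the first (spatial) variable. -/
noncomputable def pdX (f : ℝ × ℝ → ℝ) (p : ℝ × ℝ) : ℝ :=
  deriv (fun x => f (x, p.2)) p.1

/-- Partial derivative with respect to the second (time) variable. -/
noncomputable def pdT (f : ℝ × ℝ → ℝ) (p : ℝ × ℝ) : ℝ :=
  deriv (fun t => f (p.1, t)) p.2

theorem hasDerivAt_pdX {f : ℝ × ℝ → ℝ} (hf : Differentiable ℝ f) (p : ℝ × ℝ) :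
    HasDerivAt (fun x => f (x, p.2)) (pdX f p) p.1 :=
  DifferentiableAt.hasDerivAt (by fun_prop)

theorem hasDerivAt_pdT {f : ℝ × ℝ → ℝ} (hf : Differentiable ℝ f) (p : ℝ × ℝ) :
    HasDerivAt (fun t => f (p.1, t)) (pdT f p) p.2 :=
  DifferentiableAt.hasDerivAt (by fun_prop)

theorem pdX_eq_fderiv {f : ℝ × ℝ → ℝ} (hf : Differentiable ℝ f) :
    pdX f = fun p => fderiv ℝ f p (1, 0) := by
  funext p
  exact ((hf p).hasFDerivAt.comp_hasDerivAt p.1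
    ((hasDerivAt_id p.1).prodMk (hasDerivAt_const p.1 p.2))).deriv

theorem pdT_eq_fderiv {f : ℝ × ℝ → ℝ} (hf : Differentiable ℝ f) :
    pdT f = fun p => fderiv ℝ f p (0, 1) := by
  funext p
  exact ((hf p).hasFDerivAt.comp_hasDerivAt p.2
    ((hasDerivAt_const p.2 p.1).prodMk (hasDerivAt_id p.2))).deriv

theorem ContDiff.differentiable_fderiv_two {f : ℝ × ℝ → ℝ} (hf : ContDiff ℝ 2 f) :
    Differentiable ℝ (fderiv ℝ f) :=
  (hf.fderiv_right (m := 1) (by norm_num)).differentiable (by norm_num)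

theorem differentiable_pdX {f : ℝ × ℝ → ℝ} (hf : ContDiff ℝ 2 f) :
    Differentiable ℝ (pdX f) := by
  rw [pdX_eq_fderiv (hf.differentiable (by norm_num))]
  exact hf.differentiable_fderiv_two.clm_apply (differentiable_const _)

theorem differentiable_pdT {f : ℝ × ℝ → ℝ} (hf : ContDiff ℝ 2 f) :
    Differentiable ℝ (pdT f) := by
  rw [pdT_eq_fderiv (hf.differentiable (by norm_num))]
  exact hf.differentiable_fderiv_two.clm_apply (differentiable_const _)

/-- Mixed partial derivatives of a `C²` function commute. -/
theorem pdX_pdT_comm {f : ℝ × ℝ → ℝ} (hf : ContDiff ℝ 2 f) (p : ℝ × ℝ) :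
    pdX (pdT f) p = pdT (pdX f) p := by
  have hd : Differentiable ℝ f := hf.differentiable (by norm_num)
  have happly (a b : ℝ × ℝ) :
      fderiv ℝ (fun q => fderiv ℝ f q a) p b = fderiv ℝ (fderiv ℝ f) p b a := by
    rw [fderiv_clm_apply (hf.differentiable_fderiv_two p) (differentiableAt_const a)]
    simp
  have hsymm : IsSymmSndFDerivAt ℝ f p := hf.contDiffAt.isSymmSndFDerivAt (by simp)
  rw [pdX_eq_fderiv (differentiable_pdT hf), pdT_eq_fderiv (differentiable_pdX hf),
    pdX_eq_fderiv hd, pdT_eq_fderiv hd]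
  simp only [happly]
  exact hsymm.eq _ _

/-- If `u, w` are `C²` functions of `(x̄, t)` satisfying the coupled
first-order system
`∂u/∂t + ((λ−μ)/(λ+μ))·(v/2)·∂u/∂x̄ + (v/2)·∂w/∂x̄ = 0` and
`∂w/∂t + ((λ−μ)/(λ+μ))·(v/2)·∂w/∂x̄ + (v/2)·∂u/∂x̄ = −(λ−μ)·u − (λ+μ)·w`,
then `u` satisfies the asymmetric telegrapher's equation
`(λ·μ·v²/(λ+μ)³)·∂²u/∂x̄² − (1/(λ+μ))·∂²u/∂t² − (v·(λ−μ)/(λ+μ)²)·∂²u/∂t∂x̄ = ∂u/∂t`. -/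
theorem stmt13 (lam mu v : ℝ) (hlam : 0 ≤ lam) (hmu : 0 ≤ mu) (hlm : 0 < lam + mu)
    (u w : ℝ × ℝ → ℝ) (hu : ContDiff ℝ 2 u) (hw : ContDiff ℝ 2 w)
    (heq1 : ∀ p : ℝ × ℝ,
      pdT u p + ((lam - mu) / (lam + mu)) * (v / 2) * pdX u p + (v / 2) * pdX w p = 0)
    (heq2 : ∀ p : ℝ × ℝ,
      pdT w p + ((lam - mu) / (lam + mu)) * (v / 2) * pdX w p + (v / 2) * pdX u p
        = -(lam - mu) * u p - (lam + mu) * w p) :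
    ∀ p : ℝ × ℝ,
      (lam * mu * v ^ 2 / (lam + mu) ^ 3) * pdX (pdX u) p
        - (1 / (lam + mu)) * pdT (pdT u) p
        - (v * (lam - mu) / (lam + mu) ^ 2) * pdT (pdX u) p
      = pdT u p := by
  intro p
  have hdu : Differentiable ℝ u := hu.differentiable (by norm_num)
  have hdw : Differentiable ℝ w := hw.differentiable (by norm_num)
  set a := (lam - mu) / (lam + mu) * (v / 2) with ha
  have heq1_t : pdT (pdT u) p + a * pdT (pdX u) p + v / 2 * pdT (pdX w) p = 0 :=
    (((hasDerivAt_pdT (differentiable_pdT hu) p).add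
      ((hasDerivAt_pdT (differentiable_pdX hu) p).const_mul a)).add
      ((hasDerivAt_pdT (differentiable_pdX hw) p).const_mul (v / 2))).unique
      ((hasDerivAt_const p.2 (0 : ℝ)).congr_of_eventuallyEq
        (.of_forall fun t => heq1 (p.1, t)))
  have heq1_x : pdX (pdT u) p + a * pdX (pdX u) p + v / 2 * pdX (pdX w) p = 0 :=
    (((hasDerivAt_pdX (differentiable_pdT hu) p).add
      ((hasDerivAt_pdX (differentiable_pdX hu) p).const_mul a)).add
      ((hasDerivAt_pdX (differentiable_pdX hw) p).const_mul (v / 2))).unique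
      ((hasDerivAt_const p.1 (0 : ℝ)).congr_of_eventuallyEq
        (.of_forall fun x => heq1 (x, p.2)))
  have heq2_x : pdX (pdT w) p + a * pdX (pdX w) p + v / 2 * pdX (pdX u) p
      = -(lam - mu) * pdX u p - (lam + mu) * pdX w p :=
    (((hasDerivAt_pdX (differentiable_pdT hw) p).add
      ((hasDerivAt_pdX (differentiable_pdX hw) p).const_mul a)).add
      ((hasDerivAt_pdX (differentiable_pdX hu) p).const_mul (v / 2))).unique
      ((((hasDerivAt_pdX hdu p).const_mul (-(lam - mu))).sub
        ((hasDerivAt_pdX hdw p).const_mul (lam + mu))).congr_of_eventuallyEq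
        (.of_forall fun x => heq2 (x, p.2)))
  rw [pdX_pdT_comm hu] at heq1_x
  rw [pdX_pdT_comm hw] at heq2_x
  have hs : lam + mu ≠ 0 := hlm.ne'
  have hsa : (lam + mu) * a = (lam - mu) * (v / 2) := by rw [ha]; field_simp
  have htelegraph : pdT (pdT u) p + 2 * a * pdT (pdX u) p
      + (a ^ 2 - (v / 2) ^ 2) * pdX (pdX u) p + (lam + mu) * pdT u p = 0 := by
    linear_combination heq1_t + a * heq1_x - v / 2 * heq2_x + (lam + mu) * heq1 p
      - pdX u p * hsa
  have hut : pdT u p = -(pdT (pdT u) p + 2 * a * pdT (pdX u) p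
      + (a ^ 2 - (v / 2) ^ 2) * pdX (pdX u) p) / (lam + mu) := by
    rw [eq_div_iff hs]
    linear_combination htelegraph
  rw [hut, ha]
  field_simp
  ring
end

section
/- Let D > 0, v ∈ ℝ and c > √(2·D). Define, for Δt > 0, β(Δt) = D/c² + v²·Δt/(2·c²) + v·√Δt/(2·c), δ(Δt) = D/c² + v²·Δt/(2·c²) − v·√Δt/(2·c) and α(Δt) = 1 − 2·D/c² − v²·Δt/c². Then there exists ε > 0 such that for all Δt ∈ (0, ε): β(Δt), δ(Δt), α(Δt) ∈ [0, 1] and β(Δt) + δ(Δt) + α(Δt) = 1. -/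
/-- Under the diffusive scaling `Δx = c·√Δt` with `c > √(2D)`, the
right-step, left-step and stay weights
`β(Δt) = D/c² + v²·Δt/(2c²) + v·√Δt/(2c)`,
`δ(Δt) = D/c² + v²·Δt/(2c²) − v·√Δt/(2c)`,
`α(Δt) = 1 − 2D/c² − v²·Δt/c²`
form a genuine probability vector for all sufficiently small `Δt > 0`. -/
theorem stmt16 (D v c : ℝ) (hD : 0 < D) (hc : Real.sqrt (2 * D) < c)
    (β δ α : ℝ → ℝ)
    (hβ : ∀ Δt, β Δt = D / c ^ 2 + v ^ 2 * Δt / (2 * c ^ 2)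
      + v * Real.sqrt Δt / (2 * c))
    (hδ : ∀ Δt, δ Δt = D / c ^ 2 + v ^ 2 * Δt / (2 * c ^ 2)
      - v * Real.sqrt Δt / (2 * c))
    (hα : ∀ Δt, α Δt = 1 - 2 * D / c ^ 2 - v ^ 2 * Δt / c ^ 2) :
    ∃ ε > (0 : ℝ), ∀ Δt ∈ Set.Ioo (0 : ℝ) ε,
      β Δt ∈ Set.Icc (0 : ℝ) 1 ∧ δ Δt ∈ Set.Icc (0 : ℝ) 1 ∧
      α Δt ∈ Set.Icc (0 : ℝ) 1 ∧ β Δt + δ Δt + α Δt = 1 := by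
  have hc0 : 0 < c := (Real.sqrt_nonneg _).trans_lt hc
  have hDc : 2 * D < c ^ 2 := (Real.sqrt_lt' hc0).1 hc
  have hβ_cont : Continuous β := by
    rw [funext hβ]
    fun_prop
  have hδ_cont : Continuous δ := by
    rw [funext hδ]
    fun_prop
  have hα_cont : Continuous α := by
    rw [funext hα]
    fun_prop
  have hβ_zero : 0 < β 0 := by
    simp only [hβ, mul_zero, zero_div, Real.sqrt_zero, add_zero]
    positivity
  have hδ_zero : 0 < δ 0 := by
    simp only [hδ, mul_zero, zero_div, Real.sqrt_zero, add_zero, sub_zero]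
    positivity
  have hα_zero : 0 < α 0 := by
    simp only [hα, mul_zero, zero_div, sub_zero, sub_pos]
    exact (div_lt_one (by positivity)).2 hDc
  have h_pos := ((hβ_cont.continuousAt.eventually_const_lt hβ_zero).and
    (hδ_cont.continuousAt.eventually_const_lt hδ_zero)).and
    (hα_cont.continuousAt.eventually_const_lt hα_zero)
  obtain ⟨ε, hε, h⟩ := Metric.eventually_nhds_iff.1 h_pos
  refine ⟨ε, hε, fun t ht => ?_⟩
  obtain ⟨⟨hβt, hδt⟩, hαt⟩ := @h t (by
    rw [Real.dist_eq, sub_zero, abs_of_pos ht.1]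
    exact ht.2)
  have h_sum : β t + δ t + α t = 1 := by
    rw [hβ, hδ, hα]
    field_simp
    ring
  exact ⟨⟨hβt.le, by linarith⟩, ⟨hδt.le, by linarith⟩, ⟨hαt.le, by linarith⟩, h_sum⟩
end
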